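/- Let ℓ be an odd prime and let B : ℤ × ℤ → ℤ be a function satisfying, for all integers D ≥ 1 and d ≥ 0, the recurrence B(D, ℓ²d) = ℓ·B(ℓ²D, d) + (D/ℓ)·B(D,d) + B(D/ℓ², d) − ℓ·B(D, d/ℓ²) − (−d/ℓ)·B(D,d). Let d ≥ 1 be an integer not divisible by ℓ with Legendre symbol (−d/ℓ) = 1. Then for all n ≥ 1 one has B(1, ℓ^{2n} d) = ℓⁿ·B(ℓ^{2n}, d); in particular ℓⁿ divides B(1, ℓ^{2n} d). -/

import Mathlib

/-- A doubly indexed sequence satisfying the Hecke-type recurrence has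
`a 0 n = x ^ n * a n 0`: the defects `a i (j + 1) - x * a (i + 1) j` are constant along diagonals
and their weighted antidiagonal sums cancel in pairs. -/
theorem eq_pow_mul_of_hecke_recurrence (x : ℤ) (a : ℕ → ℕ → ℤ)
    (h₀₀ : a 0 1 = x * a 1 0)
    (h₀ : ∀ j, a 0 (j + 2) = x * a 1 (j + 1) + a 0 (j + 1) - x * a 0 j)
    (h₁ : ∀ i, a (i + 1) 1 = x * a (i + 2) 0 + a i 0 - a (i + 1) 0)
    (h : ∀ i j, a (i + 1) (j + 2) = x * a (i + 2) (j + 1) + a i (j + 1) - x * a (i + 1) j)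
    (n : ℕ) : a 0 n = x ^ n * a n 0 := by
  have diag : ∀ t i j, a (i + t) (j + t + 1) - x * a (i + t + 1) (j + t) =
      a i (j + 1) - x * a (i + 1) j := by
    intro t i j
    induction t with
    | zero => rfl
    | succ t ih =>
      rw [← ih]
      have := h (i + t) (j + t)
      simp only [← add_assoc] at this ⊢
      linear_combination this
  induction n using Nat.strong_induction_on with
  | _ n ih =>
    set f : ℕ → ℤ := fun k => x ^ k * a k (n - k) - x ^ (k + 1) * a (k + 1) (n - (k + 1)) with hf
    have tele : ∑ k ∈ Finset.range n, f k = a 0 n - x ^ n * a n 0 := by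
      rw [hf, Finset.sum_range_sub' (fun k => x ^ k * a k (n - k))]
      simp
    have pair_of_le : ∀ k p, n = k + (k + p) + 1 → f k + f (k + p) = 0 := by
      intro k p hn
      have e₁ : n - k = k + p + 1 := by omega
      have e₂ : n - (k + 1) = k + p := by omega
      have e₃ : n - (k + p) = k + 1 := by omega
      have e₄ : n - (k + p + 1) = k := by omega
      simp only [hf, e₁, e₂, e₃, e₄]
      have d₁ := diag k 0 p
      have d₂ := diag k p 0
      simp only [zero_add, add_comm p k] at d₁ d₂
      cases p with
      | zero =>
        simp only [add_zero, zero_add] at d₁ ⊢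
        linear_combination 2 * x ^ k * d₁ + 2 * x ^ k * h₀₀
      | succ q =>
        have i₁ := ih (q + 1) (by omega)
        have i₀ := ih q (by omega)
        linear_combination x ^ k * d₁ + x ^ (k + (q + 1)) * d₂ + x ^ k * h₀ q +
          x ^ (k + (q + 1)) * h₁ q + x ^ k * i₁ - x ^ (k + 1) * i₀
    have pair : ∀ k ∈ Finset.range n, f k + f (n - 1 - k) = 0 := by
      intro k hk
      rw [Finset.mem_range] at hk
      rcases le_total k (n - 1 - k) with hle | hle
      · obtain ⟨p, hp⟩ := Nat.exists_eq_add_of_le hle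
        rw [hp]
        exact pair_of_le k p (by omega)
      · obtain ⟨p, hp⟩ := Nat.exists_eq_add_of_le hle
        have := pair_of_le (n - 1 - k) p (by omega)
        rwa [← hp, add_comm] at this
    have total := Finset.sum_eq_zero pair
    rw [Finset.sum_add_distrib, Finset.sum_range_reflect, tele] at total
    linarith


/-- arithmetic kernel of Theorem 3.3: from the one-step recurrence,
if `d ≥ 1`, `ℓ ∤ d` and the Legendre symbol `(−d/ℓ) = 1`, then for all `n ≥ 1`
one has `B(1, ℓ^(2n) d) = ℓⁿ · B(ℓ^(2n), d)`; in particular `ℓⁿ ∣ B(1, ℓ^(2n) d)`.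
Here `legendreSym ℓ m : ℤ` is the Legendre symbol, and `B(m/ℓ², d)` is interpreted
as `0` unless `ℓ² ∣ m` (encoded via `if` expressions). -/
theorem stmt_2 (ℓ : ℕ) [Fact ℓ.Prime] (hℓodd : Odd ℓ)
    (B : ℤ × ℤ → ℤ)
    (hrec : ∀ D d : ℤ, 1 ≤ D → 0 ≤ d →
      B (D, (ℓ : ℤ) ^ 2 * d) =
        (ℓ : ℤ) * B ((ℓ : ℤ) ^ 2 * D, d) + legendreSym ℓ D * B (D, d)
          + (if (ℓ : ℤ) ^ 2 ∣ D then B (D / (ℓ : ℤ) ^ 2, d) else 0)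
          - (ℓ : ℤ) * (if (ℓ : ℤ) ^ 2 ∣ d then B (D, d / (ℓ : ℤ) ^ 2) else 0)
          - legendreSym ℓ (-d) * B (D, d))
    (d : ℤ) (hd : 1 ≤ d) (hℓd : ¬ (ℓ : ℤ) ∣ d)
    (hleg : legendreSym ℓ (-d) = 1) :
    ∀ n : ℕ, 1 ≤ n →
      B (1, (ℓ : ℤ) ^ (2 * n) * d) = (ℓ : ℤ) ^ n * B ((ℓ : ℤ) ^ (2 * n), d) ∧
      (ℓ : ℤ) ^ n ∣ B (1, (ℓ : ℤ) ^ (2 * n) * d) := by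
  have hprime : ℓ.Prime := Fact.out
  have hx : (0 : ℤ) < ℓ := by exact_mod_cast hprime.pos
  have hx2 : (ℓ : ℤ) ^ 2 ≠ 0 := by positivity
  have hpow : ∀ i : ℕ, (ℓ : ℤ) ^ (2 * (i + 1)) = (ℓ : ℤ) ^ 2 * (ℓ : ℤ) ^ (2 * i) := by
    intro i; ring
  have hmul : ∀ j : ℕ, (ℓ : ℤ) ^ (2 * (j + 1)) * d = (ℓ : ℤ) ^ 2 * ((ℓ : ℤ) ^ (2 * j) * d) := by
    intro j; ring
  have hpos : ∀ i : ℕ, (1 : ℤ) ≤ (ℓ : ℤ) ^ (2 * i) := fun i => Int.add_one_le_of_lt (pow_pos hx _)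
  have hnonneg : ∀ j : ℕ, (0 : ℤ) ≤ (ℓ : ℤ) ^ (2 * j) * d := fun j => by positivity
  have leg_zero : ∀ m : ℤ, (ℓ : ℤ) ∣ m → legendreSym ℓ m = 0 := fun m hm =>
    (legendreSym.eq_zero_iff ℓ m).2 ((ZMod.intCast_zmod_eq_zero_iff_dvd m ℓ).2 hm)
  have leg_D : ∀ i : ℕ, legendreSym ℓ ((ℓ : ℤ) ^ (2 * (i + 1))) = 0 := fun i =>
    leg_zero _ (dvd_pow_self _ (by omega))
  have leg_d : ∀ j : ℕ, legendreSym ℓ (-((ℓ : ℤ) ^ (2 * (j + 1)) * d)) = 0 := fun j =>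
    leg_zero _ ((dvd_pow_self _ (by omega)).mul_right _).neg_right
  have not_dvd_one : ¬ (ℓ : ℤ) ^ 2 ∣ 1 := fun hdvd =>
    hℓd (((dvd_pow_self _ two_ne_zero).trans hdvd).trans (one_dvd d))
  have not_dvd_d : ¬ (ℓ : ℤ) ^ 2 ∣ d := fun hdvd =>
    hℓd ((dvd_pow_self _ two_ne_zero).trans hdvd)
  have key := eq_pow_mul_of_hecke_recurrence (ℓ : ℤ)
    (fun i j => B ((ℓ : ℤ) ^ (2 * i), (ℓ : ℤ) ^ (2 * j) * d)) ?_ ?_ ?_ ?_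
  · intro n _
    have hn := key n
    simp only [mul_zero, pow_zero, one_mul] at hn
    exact ⟨hn, hn ▸ dvd_mul_right _ _⟩
  · have := hrec 1 d le_rfl (by omega)
    rw [if_neg not_dvd_one, if_neg not_dvd_d, legendreSym.at_one, hleg] at this
    simp only [mul_zero, mul_one, pow_zero, one_mul] at this ⊢
    linear_combination this
  · intro j
    have := hrec 1 _ le_rfl (hnonneg (j + 1))
    rw [← hmul, leg_d, if_neg not_dvd_one, legendreSym.at_one, hmul j,
      if_pos (dvd_mul_right _ _), Int.mul_ediv_cancel_left _ hx2, ← hmul] at this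
    simp only [mul_zero, mul_one, pow_zero] at this ⊢
    linear_combination this
  · intro i
    have := hrec _ d (hpos (i + 1)) (by omega)
    rw [← hpow, leg_D, if_neg not_dvd_d, hleg, hpow i,
      if_pos (dvd_mul_right _ _), Int.mul_ediv_cancel_left _ hx2, ← hpow] at this
    simp only [mul_zero, mul_one, pow_zero, one_mul] at this ⊢
    linear_combination this
  · intro i j
    have := hrec _ _ (hpos (i + 1)) (hnonneg (j + 1))
    rw [← hpow, ← hmul, leg_D, leg_d, hpow i, hmul j,
      if_pos (dvd_mul_right _ _), if_pos (dvd_mul_right _ _), Int.mul_ediv_cancel_left _ hx2,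
      Int.mul_ediv_cancel_left _ hx2, ← hpow, ← hmul] at this
    linear_combination this
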